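/- arXiv:2111.12931 — 2 statements merged into one kernel-verified Lean document; each statement's English description precedes it below -/
import Mathlib

section
/- Let d ∈ {2,3} and γ > 0. There exists a constant C > 0 depending only on d and γ such that for every integer N ≥ 1, | Σ_{k∈ℤ^d₀, N≤|k|≤2N} |k|^{−2γ} − ∫_{{x∈ℝ^d: N≤|x|≤2N}} |x|^{−2γ} dx | ≤ (C/N) Λ_N², where Λ_N² = Σ_{k∈ℤ^d₀, N≤|k|≤2N} |k|^{−2γ}. -/
open scoped BigOperators
open Real MeasureTheory

noncomputable section

/-- Embedding of an integer lattice point into Euclidean space. -/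
def toE {d : ℕ} (k : Fin d → ℤ) : EuclideanSpace ℝ (Fin d) :=
  (WithLp.equiv 2 (Fin d → ℝ)).symm (fun i => (k i : ℝ))

/-- `Λ_N² = Σ_{k∈ℤ^d₀, N ≤ |k| ≤ 2N} |k|^{-2γ}`. -/
def Lam2 (d : ℕ) (γ : ℝ) (N : ℕ) : ℝ :=
  ∑' k : {k : Fin d → ℤ // k ≠ 0},
    if (N : ℝ) ≤ ‖toE k.1‖ ∧ ‖toE k.1‖ ≤ 2 * N then ‖toE k.1‖ ^ (-(2 * γ)) else 0

/-- On `EuclideanSpace ℝ ι` the Euclidean norm is bounded by the `ℓ¹` norm. -/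
lemma EuclideanSpace.norm_le_sum_abs {ι : Type*} [Fintype ι] (x : EuclideanSpace ℝ ι) :
    ‖x‖ ≤ ∑ i, |x i| := by
  rw [EuclideanSpace.norm_eq, Real.sqrt_le_left (by positivity)]
  exact Finset.sum_sq_le_sq_sum_of_nonneg fun i _ => abs_nonneg _

/-- The points with coordinatewise floor `k` form a unit cube. -/
lemma floor_eq_preimage {d : ℕ} (k : Fin d → ℤ) :
    {x : EuclideanSpace ℝ (Fin d) | (fun i => ⌊x i⌋) = k} =
      WithLp.ofLp ⁻¹' (Set.univ.pi fun i => Set.Ico (k i : ℝ) (k i + 1)) := by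
  ext x
  simp [funext_iff, Int.floor_eq_iff]

lemma measurableSet_floor_eq {d : ℕ} (k : Fin d → ℤ) :
    MeasurableSet {x : EuclideanSpace ℝ (Fin d) | (fun i => ⌊x i⌋) = k} := by
  rw [floor_eq_preimage]
  exact (PiLp.volume_preserving_ofLp (Fin d)).measurable
    (MeasurableSet.univ_pi fun i => measurableSet_Ico)

lemma volume_floor_eq {d : ℕ} (k : Fin d → ℤ) :
    volume {x : EuclideanSpace ℝ (Fin d) | (fun i => ⌊x i⌋) = k} = 1 := by
  rw [floor_eq_preimage, (PiLp.volume_preserving_ofLp (Fin d)).measure_preimage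
    (MeasurableSet.univ_pi fun i => measurableSet_Ico).nullMeasurableSet, Real.volume_pi_Ico]
  simp

/-- A finitely supported function of the lattice, extended to be constant on unit cubes. -/
lemma comp_floor_eq_sum_indicator {d : ℕ} {F : (Fin d → ℤ) → ℝ} {S : Finset (Fin d → ℤ)}
    (hF : ∀ k ∉ S, F k = 0) :
    (fun x : EuclideanSpace ℝ (Fin d) => F fun i => ⌊x i⌋) = fun x => ∑ k ∈ S,
      {x : EuclideanSpace ℝ (Fin d) | (fun i => ⌊x i⌋) = k}.indicator (fun _ => F k) x := by
  funext x
  by_cases hx : (fun i => ⌊x i⌋) ∈ S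
  · rw [Finset.sum_eq_single_of_mem _ hx]
    · simp
    · intro k _ hk
      exact Set.indicator_of_notMem (fun h => hk h.symm) _
  · rw [hF _ hx, Finset.sum_eq_zero]
    intro k hk
    refine Set.indicator_of_notMem (fun h => hx ?_) _
    exact (show (fun i => ⌊x i⌋) = k from h) ▸ hk

lemma integrable_indicator_floor_eq {d : ℕ} (k : Fin d → ℤ) (c : ℝ) :
    Integrable ({x : EuclideanSpace ℝ (Fin d) | (fun i => ⌊x i⌋) = k}.indicator fun _ => c) := by
  rw [integrable_indicator_iff (measurableSet_floor_eq k)]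
  exact integrableOn_const (by simp [volume_floor_eq])

lemma integrable_comp_floor {d : ℕ} {F : (Fin d → ℤ) → ℝ} {S : Finset (Fin d → ℤ)}
    (hF : ∀ k ∉ S, F k = 0) :
    Integrable fun x : EuclideanSpace ℝ (Fin d) => F fun i => ⌊x i⌋ := by
  rw [comp_floor_eq_sum_indicator hF]
  exact integrable_finsetSum _ fun k _ => integrable_indicator_floor_eq k _

lemma integral_comp_floor {d : ℕ} {F : (Fin d → ℤ) → ℝ} {S : Finset (Fin d → ℤ)}
    (hF : ∀ k ∉ S, F k = 0) :
    ∫ x : EuclideanSpace ℝ (Fin d), F (fun i => ⌊x i⌋) = ∑ k ∈ S, F k := by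
  rw [comp_floor_eq_sum_indicator hF,
    integral_finsetSum _ fun k _ => integrable_indicator_floor_eq k _]
  refine Finset.sum_congr rfl fun k _ => ?_
  rw [integral_indicator_const _ (measurableSet_floor_eq k), measureReal_def, volume_floor_eq]
  simp

lemma toE_apply {d : ℕ} (k : Fin d → ℤ) (i : Fin d) : toE k i = k i := rfl

lemma abs_norm_toE_floor_sub_norm_le {d : ℕ} (x : EuclideanSpace ℝ (Fin d)) :
    |‖toE fun i => ⌊x i⌋‖ - ‖x‖| ≤ d := by
  refine (abs_norm_sub_norm_le _ _).trans ((EuclideanSpace.norm_le_sum_abs _).trans ?_)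
  calc ∑ i, |(toE (fun i => ⌊x i⌋) - x) i| ≤ ∑ _i : Fin d, (1 : ℝ) := by
        refine Finset.sum_le_sum fun i _ => ?_
        rw [PiLp.sub_apply, toE_apply, abs_le]
        constructor <;> linarith [Int.floor_le (x i), Int.lt_floor_add_one (x i)]
    _ = d := by simp

/-- The profile `r ↦ r ^ (-p)` truncated to `[N, 2N]`. -/
def annulusProfile (p N r : ℝ) : ℝ := if N ≤ r ∧ r ≤ 2 * N then r ^ (-p) else 0

lemma abs_rpow_neg_sub_rpow_neg_le {p N a b : ℝ} (hp : 0 ≤ p) (hN : 0 < N) (ha : N ≤ a)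
    (hb : N ≤ b) : |b ^ (-p) - a ^ (-p)| ≤ p * N ^ (-p - 1) * |b - a| := by
  refine Convex.norm_image_sub_le_of_norm_hasDerivWithin_le (s := Set.Ici N)
    (f := fun x : ℝ => x ^ (-p)) (f' := fun x => -p * x ^ (-p - 1)) (fun x hx => ?_)
    (fun x hx => ?_) (convex_Ici N) ha hb
  · exact (Real.hasDerivAt_rpow_const (Or.inl (hN.trans_le hx).ne')).hasDerivWithinAt
  · have hx0 : 0 < x := hN.trans_le hx
    rw [norm_mul, Real.norm_eq_abs, Real.norm_eq_abs, abs_neg, abs_of_nonneg hp,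
      abs_of_nonneg (by positivity)]
    exact mul_le_mul_of_nonneg_left
      (Real.rpow_le_rpow_of_nonpos hN hx (by linarith)) hp

lemma annulusProfile_nonneg {p N r : ℝ} (hN : 0 ≤ N) : 0 ≤ annulusProfile p N r := by
  unfold annulusProfile
  split_ifs with h
  · exact Real.rpow_nonneg (hN.trans h.1) _
  · rfl

lemma annulusProfile_le {p N r : ℝ} (hp : 0 ≤ p) (hN : 0 < N) :
    annulusProfile p N r ≤ N ^ (-p) := by
  unfold annulusProfile
  split_ifs with h
  · exact Real.rpow_le_rpow_of_nonpos hN h.1 (by linarith)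
  · positivity

/-- Variation of the truncated profile: Lipschitz inside, a jump near the two end points. -/
lemma abs_annulusProfile_sub_le {p N s a b : ℝ} (hp : 0 ≤ p) (hN : 0 < N)
    (hs : |a - b| ≤ s) :
    |annulusProfile p N a - annulusProfile p N b| ≤
      (Set.Icc 0 (2 * N)).indicator (fun _ => p * N ^ (-p - 1) * s) b
      + (Set.Icc (N - s) (N + s)).indicator (fun _ => N ^ (-p)) b
      + (Set.Icc (2 * N - s) (2 * N + s)).indicator (fun _ => N ^ (-p)) b := by
  have hs0 : 0 ≤ s := (abs_nonneg _).trans hs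
  have h1 : 0 ≤ (Set.Icc 0 (2 * N)).indicator (fun _ => p * N ^ (-p - 1) * s) b :=
    Set.indicator_nonneg (fun _ _ => by positivity) _
  have h2 : 0 ≤ (Set.Icc (N - s) (N + s)).indicator (fun _ => N ^ (-p)) b :=
    Set.indicator_nonneg (fun _ _ => by positivity) _
  have h3 : 0 ≤ (Set.Icc (2 * N - s) (2 * N + s)).indicator (fun _ => N ^ (-p)) b :=
    Set.indicator_nonneg (fun _ _ => by positivity) _
  have hjump : |annulusProfile p N a - annulusProfile p N b| ≤ N ^ (-p) := by
    have := annulusProfile_nonneg (p := p) (r := a) hN.le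
    have := annulusProfile_nonneg (p := p) (r := b) hN.le
    have := annulusProfile_le (r := a) hp hN
    have := annulusProfile_le (r := b) hp hN
    rw [abs_le]
    constructor <;> linarith
  obtain ⟨hs1, hs2⟩ := abs_le.mp hs
  by_cases hbN : b ∈ Set.Icc (N - s) (N + s)
  · rw [Set.indicator_of_mem hbN]
    linarith
  by_cases hb2N : b ∈ Set.Icc (2 * N - s) (2 * N + s)
  · rw [Set.indicator_of_mem hb2N]
    linarith
  rw [Set.mem_Icc, not_and_or, not_le, not_le] at hbN hb2N
  by_cases hb : N ≤ b ∧ b ≤ 2 * N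
  · have ha : N ≤ a ∧ a ≤ 2 * N := by grind
    rw [Set.indicator_of_mem (Set.mem_Icc.2 ⟨hN.le.trans hb.1, hb.2⟩), annulusProfile,
      annulusProfile, if_pos ha, if_pos hb]
    have := abs_rpow_neg_sub_rpow_neg_le hp hN hb.1 ha.1
    have := mul_le_mul_of_nonneg_left hs (by positivity : 0 ≤ p * N ^ (-p - 1))
    linarith
  · have ha : ¬ (N ≤ a ∧ a ≤ 2 * N) := by grind
    rw [annulusProfile, annulusProfile, if_neg ha, if_neg hb, sub_zero, abs_zero]
    positivity

/-- The volume of the shell `{x | a ≤ ‖x‖ ≤ b}` is at most its thickness times the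
area of the outer sphere. -/
lemma volume_real_shell_le {d : ℕ} [NeZero d] {a b : ℝ} (hb : 0 ≤ b) (hab : a ≤ b) :
    volume.real {x : EuclideanSpace ℝ (Fin d) | ‖x‖ ∈ Set.Icc a b} ≤
      (b - a) * d * b ^ (d - 1) * volume.real (Metric.ball (0 : EuclideanSpace ℝ (Fin d)) 1) := by
  set μ1 := volume.real (Metric.ball (0 : EuclideanSpace ℝ (Fin d)) 1)
  set a' := max a 0
  have ha' : 0 ≤ a' := le_max_right _ _
  have hab' : a' ≤ b := max_le hab hb
  have hset : {x : EuclideanSpace ℝ (Fin d) | ‖x‖ ∈ Set.Icc a b} =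
      Metric.closedBall 0 b \ Metric.ball 0 a' := by
    ext x
    simp [a', and_comm]
  have hball : volume.real (Metric.ball (0 : EuclideanSpace ℝ (Fin d)) a') = a' ^ d * μ1 := by
    rw [measureReal_def, Measure.addHaar_ball _ _ ha', ENNReal.toReal_mul,
      ENNReal.toReal_ofReal (by positivity), finrank_euclideanSpace_fin]
    rfl
  rw [hset, measureReal_sdiff (Metric.ball_subset_closedBall.trans
    (Metric.closedBall_subset_closedBall hab')) measurableSet_ball
    measure_closedBall_lt_top.ne, Measure.addHaar_real_closedBall _ _ hb, hball,
    finrank_euclideanSpace_fin, ← sub_mul]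
  refine mul_le_mul_of_nonneg_right ?_ measureReal_nonneg
  calc b ^ d - a' ^ d ≤ |b - a'| * d * max |b| |a'| ^ (d - 1) :=
        (le_abs_self _).trans (abs_pow_sub_pow_le _ _ _)
    _ = (b - a') * d * b ^ (d - 1) := by
        rw [abs_of_nonneg (sub_nonneg.2 hab'), abs_of_nonneg hb, abs_of_nonneg ha',
          max_eq_left hab']
    _ ≤ (b - a) * d * b ^ (d - 1) := by
        gcongr
        exact le_max_left _ _

lemma integrable_indicator_norm_mem_Icc {d : ℕ} (a b c : ℝ) :
    Integrable fun x : EuclideanSpace ℝ (Fin d) => (Set.Icc a b).indicator (fun _ => c) ‖x‖ := by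
  have hm : MeasurableSet {x : EuclideanSpace ℝ (Fin d) | ‖x‖ ∈ Set.Icc a b} :=
    measurable_norm measurableSet_Icc
  change Integrable ({x : EuclideanSpace ℝ (Fin d) | ‖x‖ ∈ Set.Icc a b}.indicator fun _ => c)
  rw [integrable_indicator_iff hm]
  refine integrableOn_const (ne_top_of_le_ne_top
    (measure_closedBall_lt_top (x := 0) (r := b)).ne (measure_mono fun x hx => ?_))
  simpa using hx.2

lemma integral_indicator_norm_mem_Icc_le {d : ℕ} [NeZero d] {a b c : ℝ} (hb : 0 ≤ b) (hab : a ≤ b)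
    (hc : 0 ≤ c) :
    ∫ x : EuclideanSpace ℝ (Fin d), (Set.Icc a b).indicator (fun _ => c) ‖x‖ ≤
      (b - a) * d * b ^ (d - 1) * volume.real (Metric.ball (0 : EuclideanSpace ℝ (Fin d)) 1)
        * c := by
  have hm : MeasurableSet {x : EuclideanSpace ℝ (Fin d) | ‖x‖ ∈ Set.Icc a b} :=
    measurable_norm measurableSet_Icc
  change ∫ x, {x : EuclideanSpace ℝ (Fin d) | ‖x‖ ∈ Set.Icc a b}.indicator (fun _ => c) x ≤ _
  rw [integral_indicator_const _ hm, smul_eq_mul]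
  exact mul_le_mul_of_nonneg_right (volume_real_shell_le hb hab) hc

/-- Lattice points of norm at most `2N` have coordinates in `[-2N, 2N]`. -/
lemma annulusProfile_norm_toE_eq_zero {d N : ℕ} {p : ℝ} {k : Fin d → ℤ}
    (hk : k ∉ Fintype.piFinset fun _ : Fin d => Finset.Icc (-(2 * N : ℤ)) (2 * N)) :
    annulusProfile p N ‖toE k‖ = 0 := by
  refine if_neg fun h => hk ?_
  rw [Fintype.mem_piFinset]
  intro i
  have h1 := (PiLp.norm_apply_le (toE k) i).trans h.2
  rw [toE_apply, Real.norm_eq_abs, abs_le] at h1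
  rw [Finset.mem_Icc]
  exact_mod_cast h1

lemma Lam2_eq_sum {d N : ℕ} {γ : ℝ} (hN : 1 ≤ N) :
    Lam2 d γ N = ∑ k ∈ Fintype.piFinset fun _ : Fin d => Finset.Icc (-(2 * N : ℤ)) (2 * N),
      annulusProfile (2 * γ) N ‖toE k‖ := by
  have h0 : Function.support (fun k : Fin d → ℤ => annulusProfile (2 * γ) N ‖toE k‖) ⊆
      {k | k ≠ 0} := by
    rintro k hk rfl
    refine hk (if_neg fun h => ?_)
    have h1 : toE (0 : Fin d → ℤ) = 0 := by
      ext i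
      simp [toE_apply]
    rw [h1, norm_zero] at h
    have : (1 : ℝ) ≤ N := by exact_mod_cast hN
    linarith [h.1]
  exact (tsum_subtype_eq_of_support_subset h0).trans
    (tsum_eq_sum fun k hk => annulusProfile_norm_toE_eq_zero hk)

lemma le_Lam2 {d N : ℕ} {γ : ℝ} (hd : 1 ≤ d) (hγ : 0 ≤ γ) (hN : 1 ≤ N) :
    ((N : ℝ) / d) ^ d * (2 * N : ℝ) ^ (-(2 * γ)) ≤ Lam2 d γ N := by
  have hN0 : (1 : ℝ) ≤ N := by exact_mod_cast hN
  have hd0 : (1 : ℝ) ≤ d := by exact_mod_cast hd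
  let i₀ : Fin d := ⟨0, hd⟩
  let lo : Fin d → ℤ := fun i => if i = i₀ then N else 0
  let B := Fintype.piFinset fun i : Fin d => Finset.Icc (lo i) (lo i + (N / d : ℕ))
  have hlo : ∀ i, 0 ≤ lo i := fun i => by
    simp only [lo]
    split_ifs <;> simp
  have hq : ((N / d : ℕ) : ℝ) ≤ N / d := Nat.cast_div_le
  have hB : ∀ k ∈ B, (N : ℝ) ≤ ‖toE k‖ ∧ ‖toE k‖ ≤ 2 * N := by
    intro k hk
    have hk' : ∀ i, (lo i : ℝ) ≤ k i ∧ (k i : ℝ) ≤ lo i + (N / d : ℕ) := fun i => by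
      obtain ⟨h1, h2⟩ := Finset.mem_Icc.1 (Fintype.mem_piFinset.1 hk i)
      exact ⟨Int.cast_le.2 h1, (Int.cast_le.2 h2).trans_eq (by rw [Int.cast_add, Int.cast_natCast])⟩
    constructor
    · have h1 := (hk' i₀).1
      simp only [lo, if_true, Int.cast_natCast] at h1
      exact h1.trans ((le_abs_self _).trans (PiLp.norm_apply_le (toE k) i₀))
    · calc ‖toE k‖ ≤ ∑ i, |(toE k) i| := EuclideanSpace.norm_le_sum_abs _
        _ ≤ ∑ i, ((lo i : ℝ) + N / d) := by
          refine Finset.sum_le_sum fun i _ => ?_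
          have h1 : (0 : ℝ) ≤ lo i := by exact_mod_cast hlo i
          rw [toE_apply, abs_of_nonneg (h1.trans (hk' i).1)]
          linarith [(hk' i).2]
        _ = 2 * N := by
          have h2 : ∑ i, (lo i : ℝ) = N := by simp [lo]
          rw [Finset.sum_add_distrib, h2]
          simp only [Finset.sum_const, Finset.card_univ, Fintype.card_fin, nsmul_eq_mul]
          field_simp
          ring
  have hcard : ((N : ℝ) / d) ^ d ≤ B.card := by
    have h1 : B.card = (N / d + 1) ^ d := by
      simp only [B, Fintype.card_piFinset, Int.card_Icc]
      rw [Finset.prod_congr rfl fun i _ => show (lo i + (N / d : ℕ) + 1 - lo i).toNat = N / d + 1 by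
        rw [add_assoc, add_sub_cancel_left]
        rfl]
      simp
    rw [h1]
    push_cast
    gcongr
    have h2 : N ≤ (N / d + 1) * d := by
      rw [mul_comm]
      exact (Nat.lt_mul_div_succ N hd).le
    rw [div_le_iff₀ (by linarith)]
    exact_mod_cast h2
  rw [Lam2_eq_sum hN]
  calc ((N : ℝ) / d) ^ d * (2 * N : ℝ) ^ (-(2 * γ))
      ≤ B.card * (2 * N : ℝ) ^ (-(2 * γ)) := by gcongr
    _ = ∑ _k ∈ B, (2 * N : ℝ) ^ (-(2 * γ)) := by simp
    _ ≤ ∑ k ∈ B, annulusProfile (2 * γ) N ‖toE k‖ := by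
        refine Finset.sum_le_sum fun k hk => ?_
        rw [annulusProfile, if_pos (hB k hk)]
        exact Real.rpow_le_rpow_of_nonpos (by linarith [(hB k hk).1]) (hB k hk).2 (by linarith)
    _ ≤ _ := by
        refine Finset.sum_le_sum_of_subset_of_nonneg (fun k hk => ?_)
          fun _ _ _ => annulusProfile_nonneg (by linarith)
        by_contra h
        have h1 := annulusProfile_norm_toE_eq_zero (p := 2 * γ) h
        rw [annulusProfile, if_pos (hB k hk)] at h1
        exact (Real.rpow_pos_of_pos (by linarith [(hB k hk).1]) _).ne' h1

lemma integral_annulus_eq {d : ℕ} (p N : ℝ) :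
    ∫ x in {x : EuclideanSpace ℝ (Fin d) | N ≤ ‖x‖ ∧ ‖x‖ ≤ 2 * N}, ‖x‖ ^ (-p) =
      ∫ x : EuclideanSpace ℝ (Fin d), annulusProfile p N ‖x‖ := by
  have hm : MeasurableSet {x : EuclideanSpace ℝ (Fin d) | N ≤ ‖x‖ ∧ ‖x‖ ≤ 2 * N} :=
    measurable_norm (measurableSet_Icc (a := N) (b := 2 * N))
  rw [← integral_indicator hm]
  refine integral_congr_ae (Filter.Eventually.of_forall fun x => ?_)
  simp only [annulusProfile, Set.indicator_apply, Set.mem_ofPred_eq]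

lemma integrable_annulusProfile_norm {d : ℕ} {p N : ℝ} (hp : 0 ≤ p) (hN : 0 < N) :
    Integrable fun x : EuclideanSpace ℝ (Fin d) => annulusProfile p N ‖x‖ := by
  refine (integrable_indicator_norm_mem_Icc N (2 * N) (N ^ (-p))).mono' ?_
    (Filter.Eventually.of_forall fun x => ?_)
  · refine (Measurable.ite ?_ ?_ measurable_const).aestronglyMeasurable
    · exact measurable_norm (measurableSet_Icc (a := N) (b := 2 * N))
    · fun_prop
  · rw [Real.norm_eq_abs, abs_of_nonneg (annulusProfile_nonneg hN.le)]
    by_cases h : ‖x‖ ∈ Set.Icc N (2 * N)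
    · rw [Set.indicator_of_mem h]
      exact annulusProfile_le hp hN
    · rw [Set.indicator_of_notMem h, annulusProfile, if_neg (by exact h)]

/-- The Riemann-sum error is of order `N ^ (d - 1 - 2γ)`. -/
lemma abs_Lam2_sub_integral_le {d N : ℕ} [NeZero d] {γ : ℝ} (hγ : 0 ≤ γ) (hN : 1 ≤ N) :
    |Lam2 d γ N
        - ∫ x in {x : EuclideanSpace ℝ (Fin d) | (N : ℝ) ≤ ‖x‖ ∧ ‖x‖ ≤ 2 * N},
            ‖x‖ ^ (-(2 * γ))|
      ≤ (4 * γ * d ^ 2 * 2 ^ (d - 1) + 4 * d ^ 2 * (2 + d : ℝ) ^ (d - 1))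
        * volume.real (Metric.ball (0 : EuclideanSpace ℝ (Fin d)) 1)
        * (N ^ (d - 1) * (N : ℝ) ^ (-(2 * γ))) := by
  have hN1 : (1 : ℝ) ≤ N := by exact_mod_cast hN
  have hN0 : (0 : ℝ) < N := by linarith
  have hp : 0 ≤ 2 * γ := by positivity
  have hd0 : (0 : ℝ) ≤ d := d.cast_nonneg
  have hzero := fun (k : Fin d → ℤ) hk => annulusProfile_norm_toE_eq_zero (N := N) (p := 2 * γ)
    (k := k) hk
  rw [Lam2_eq_sum hN, ← integral_comp_floor hzero, integral_annulus_eq,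
    ← integral_sub (integrable_comp_floor hzero) (integrable_annulusProfile_norm hp hN0),
    ← Real.norm_eq_abs]
  have i1 := integrable_indicator_norm_mem_Icc (d := d) 0 (2 * N)
    (2 * γ * (N : ℝ) ^ (-(2 * γ) - 1) * d)
  have i2 := integrable_indicator_norm_mem_Icc (d := d) (N - d) (N + d) ((N : ℝ) ^ (-(2 * γ)))
  have i3 := integrable_indicator_norm_mem_Icc (d := d) (2 * N - d) (2 * N + d)
    ((N : ℝ) ^ (-(2 * γ)))
  refine (norm_integral_le_of_norm_le ((i1.fun_add i2).fun_add i3) (Filter.Eventually.of_forall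
    fun x => abs_annulusProfile_sub_le hp hN0 (abs_norm_toE_floor_sub_norm_le x))).trans ?_
  rw [integral_add (i1.fun_add i2) i3, integral_add i1 i2]
  have b1 := integral_indicator_norm_mem_Icc_le (d := d) (a := 0) (b := 2 * N)
    (c := 2 * γ * (N : ℝ) ^ (-(2 * γ) - 1) * d) (by linarith) (by linarith) (by positivity)
  have b2 := integral_indicator_norm_mem_Icc_le (d := d) (a := N - d) (b := N + d)
    (c := (N : ℝ) ^ (-(2 * γ))) (by linarith) (by linarith) (by positivity)
  have b3 := integral_indicator_norm_mem_Icc_le (d := d) (a := 2 * N - d) (b := 2 * N + d)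
    (c := (N : ℝ) ^ (-(2 * γ))) (by linarith) (by linarith) (by positivity)
  have hμ := measureReal_nonneg (μ := (volume : Measure (EuclideanSpace ℝ (Fin d))))
    (s := Metric.ball 0 1)
  set μ1 := volume.real (Metric.ball (0 : EuclideanSpace ℝ (Fin d)) 1)
  have hdN : (d : ℝ) ≤ d * N := le_mul_of_one_le_right hd0 hN1
  have hout : ∀ r : ℝ, 0 ≤ r → r ≤ 2 * N → (r + d - (r - d)) * d * (r + d) ^ (d - 1) * μ1
      * (N : ℝ) ^ (-(2 * γ)) ≤
      2 * d ^ 2 * (2 + d : ℝ) ^ (d - 1) * μ1 * (N ^ (d - 1) * (N : ℝ) ^ (-(2 * γ))) := by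
    intro r hr hrN
    calc _ = 2 * d ^ 2 * (r + d) ^ (d - 1) * μ1 * (N : ℝ) ^ (-(2 * γ)) := by ring
      _ ≤ 2 * d ^ 2 * ((2 + d) * N) ^ (d - 1) * μ1 * (N : ℝ) ^ (-(2 * γ)) := by
        gcongr
        linarith
      _ = _ := by
        rw [mul_pow]
        ring
  have hin : (2 * N - 0) * d * (2 * N : ℝ) ^ (d - 1) * μ1
      * (2 * γ * (N : ℝ) ^ (-(2 * γ) - 1) * d) =
      4 * γ * d ^ 2 * 2 ^ (d - 1) * μ1 * (N ^ (d - 1) * (N : ℝ) ^ (-(2 * γ))) := by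
    rw [Real.rpow_sub_one hN0.ne', mul_pow]
    field_simp
    ring
  have := hout N hN0.le (by linarith)
  have := hout (2 * N) (by linarith) le_rfl
  linarith

/-- Riemann-sum approximation `|Λ_N² - ∫_{N≤|x|≤2N} |x|^{-2γ} dx| ≤ (C/N) Λ_N²`. -/
theorem stmt11 (d : ℕ) (hd : d = 2 ∨ d = 3) (γ : ℝ) (hγ : 0 < γ) :
    ∃ C > 0, ∀ N : ℕ, 1 ≤ N →
      |Lam2 d γ N
        - ∫ x in {x : EuclideanSpace ℝ (Fin d) | (N : ℝ) ≤ ‖x‖ ∧ ‖x‖ ≤ 2 * N},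
            ‖x‖ ^ (-(2 * γ))|
      ≤ (C / N) * Lam2 d γ N := by
  have hd1 : 1 ≤ d := by omega
  have : NeZero d := ⟨by omega⟩
  have hd0 : (0 : ℝ) < d := by exact_mod_cast hd1
  set K := (4 * γ * d ^ 2 * 2 ^ (d - 1) + 4 * d ^ 2 * (2 + d : ℝ) ^ (d - 1))
    * volume.real (Metric.ball (0 : EuclideanSpace ℝ (Fin d)) 1) with hK
  have hK0 : 0 ≤ K := by positivity
  refine ⟨K * (d ^ d * 2 ^ (2 * γ)) + 1, by positivity, fun N hN => ?_⟩
  have hN0 : (0 : ℝ) < N := by exact_mod_cast hN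
  have hlow := le_Lam2 hd1 hγ.le hN
  have hpow : (N : ℝ) ^ d = N ^ (d - 1) * N := by rw [← pow_succ, Nat.sub_add_cancel hd1]
  calc _ ≤ K * (N ^ (d - 1) * (N : ℝ) ^ (-(2 * γ))) := abs_Lam2_sub_integral_le hγ.le hN
    _ = K * (d ^ d * 2 ^ (2 * γ)) / N * (((N : ℝ) / d) ^ d * (2 * N : ℝ) ^ (-(2 * γ))) := by
        rw [Real.mul_rpow zero_le_two hN0.le, div_pow, hpow, Real.rpow_neg zero_le_two]
        field_simp
    _ ≤ (K * (d ^ d * 2 ^ (2 * γ)) + 1) / N * Lam2 d γ N := by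
        gcongr
        linarith
end
end

section
/- Let c₀ > 0, y₀ ≥ 0 and κ ≥ (5c₀/(12π²)) y₀² + 1. Suppose y : [0,∞) → [0,∞) is differentiable, y(0) = y₀, and y'(t) ≤ 2c₀ y(t)³ − (24π²/5) κ y(t) for all t ≥ 0. Then y(t) ≤ e^{−t} y₀ for all t ≥ 0. (This is the differential-inequality core of the global existence and exponential decay estimate for the deterministic 3D Navier–Stokes vorticity equation ∂_t ξ + 𝓛_u ξ = (1 + (3/5)κ) Δξ, applied with y(t) = ‖ξ_t‖²_{L²}.) -/
open Real

noncomputable section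

open Filter Topology

/-- Differential-inequality core of the exponential decay estimate for the deterministic
3D Navier–Stokes vorticity equation: if `y ≥ 0` satisfies
`y' ≤ 2c₀ y³ - (24π²/5) κ y` with `κ ≥ (5c₀/(12π²)) y(0)² + 1`, then `y(t) ≤ e^{-t} y(0)`. -/
theorem stmt19 (c₀ κ : ℝ) (hc₀ : 0 < c₀) (y y' : ℝ → ℝ)
    (hκ : 5 * c₀ / (12 * π ^ 2) * (y 0) ^ 2 + 1 ≤ κ)
    (hnonneg : ∀ t, 0 ≤ t → 0 ≤ y t)
    (hderiv : ∀ t, 0 ≤ t → HasDerivAt y (y' t) t)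
    (hineq : ∀ t, 0 ≤ t → y' t ≤ 2 * c₀ * (y t) ^ 3 - (24 * π ^ 2 / 5) * κ * y t) :
    ∀ t, 0 ≤ t → y t ≤ Real.exp (-t) * y 0 := by
  have hπ : 9 < π ^ 2 := by nlinarith [Real.pi_gt_three]
  have hcoef : 2 * c₀ * (y 0) ^ 2 + 24 * π ^ 2 / 5 ≤ 24 * π ^ 2 / 5 * κ := by
    calc 2 * c₀ * (y 0) ^ 2 + 24 * π ^ 2 / 5
        = 24 * π ^ 2 / 5 * (5 * c₀ / (12 * π ^ 2) * (y 0) ^ 2 + 1) := by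
          field_simp
          ring
      _ ≤ 24 * π ^ 2 / 5 * κ := by gcongr
  have hy0 := hnonneg 0 le_rfl
  intro T hT
  have hbound : ∀ ε : ℝ, 0 < ε → 2 * c₀ * ((y 0 + ε) ^ 2 - y 0 ^ 2) < 1 →
      y T ≤ exp (-T) * (y 0 + ε) := by
    intro ε hε hsmall
    have hB : ∀ t : ℝ, HasDerivAt (fun t => exp (-t) * (y 0 + ε))
        (-(exp (-t) * (y 0 + ε))) t := by
      intro t
      simpa using ((hasDerivAt_neg t).exp).mul_const (y 0 + ε)
    refine image_le_of_deriv_right_lt_deriv_boundary (f := y) (f' := y') (a := 0) (b := T)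
      (fun t ht => (hderiv t ht.1).continuousAt.continuousWithinAt)
      (fun t ht => (hderiv t ht.1).hasDerivWithinAt) (by simp [hε.le]) hB ?_ ⟨hT, le_rfl⟩
    intro t ht heq
    have hpos : 0 < y t := heq ▸ by positivity
    have hle : y t ≤ y 0 + ε := by
      rw [heq]
      exact mul_le_of_le_one_left (by positivity) (exp_le_one_iff.2 (by linarith [ht.1]))
    have hsq : 2 * c₀ * y t ^ 2 ≤ 2 * c₀ * (y 0 + ε) ^ 2 := by gcongr
    have hrate : 2 * c₀ * y t ^ 2 - 24 * π ^ 2 / 5 * κ < -1 := by linarith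
    rw [← heq]
    nlinarith [hineq t ht.1, mul_lt_mul_of_pos_right hrate hpos]
  have hsmall : ∀ᶠ ε in 𝓝[>] (0 : ℝ), 2 * c₀ * ((y 0 + ε) ^ 2 - y 0 ^ 2) < 1 := by
    have hcont : Continuous fun ε : ℝ => 2 * c₀ * ((y 0 + ε) ^ 2 - y 0 ^ 2) := by fun_prop
    exact nhdsWithin_le_nhds (hcont.continuousAt.eventually_lt continuousAt_const (by simp))
  have hlim : Tendsto (fun ε : ℝ => exp (-T) * (y 0 + ε)) (𝓝[>] 0) (𝓝 (exp (-T) * y 0)) := by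
    have hcont : Continuous fun ε : ℝ => exp (-T) * (y 0 + ε) := by fun_prop
    simpa using (hcont.tendsto 0).mono_left nhdsWithin_le_nhds
  refine ge_of_tendsto hlim ?_
  filter_upwards [hsmall, self_mem_nhdsWithin] with ε hε hεpos
  exact hbound ε hεpos hε
end
end
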